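/- Let S be a numerical semigroup and suppose (a_0,…,a_g) and (a'_0,…,a'_g) are two arrangements of the same positive integers (one is a permutation of the other) such that S = ⟨a_0,…,a_g⟩ is free for both arrangements, with quotients n_i and n'_i respectively. Then Σ_{i=1}^{g} (n_i − 1)·a_i − a_0 = Σ_{i=1}^{g} (n'_i − 1)·a'_i − a'_0; that is, the quantity Σ_{i=1}^{g} (n_i − 1)·a_i − a_0 + 1 (the conductor of S) is independent of the free arrangement chosen. -/

import Mathlib

/-- `eSeq a i = gcd(a 0, …, a i)`. -/
def eSeq (a : ℕ → ℕ) : ℕ → ℕ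
  | 0 => a 0
  | i + 1 => Nat.gcd (eSeq a i) (a (i + 1))

/-- `nSeq a i = e_{i-1} / e_i` (intended for `1 ≤ i`). -/
def nSeq (a : ℕ → ℕ) (i : ℕ) : ℕ := eSeq a (i - 1) / eSeq a i

/-- `gen a i = ⟨a 0, …, a i⟩`, the set of all ℕ-linear combinations. -/
def gen (a : ℕ → ℕ) (i : ℕ) : Set ℕ :=
  {s | ∃ c : ℕ → ℕ, s = ∑ j ∈ Finset.range (i + 1), c j * a j}

/-- The semigroup `S = ⟨a 0, …, a g⟩` is free for the arrangement `(a 0, …, a g)`. -/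
def IsFreeArr (a : ℕ → ℕ) (g : ℕ) : Prop :=
  eSeq a g = 1 ∧ ∀ i, 1 ≤ i → i ≤ g → nSeq a i * a i ∈ gen a (i - 1)

theorem mem_gen_zero {a : ℕ → ℕ} {s : ℕ} : s ∈ gen a 0 ↔ ∃ c, s = c * a 0 := by
  constructor
  · rintro ⟨c, hc⟩
    exact ⟨c 0, by simpa using hc⟩
  · rintro ⟨c, hc⟩
    exact ⟨fun _ => c, by simpa using hc⟩

theorem mem_gen_succ {a : ℕ → ℕ} {i s : ℕ} :
    s ∈ gen a (i + 1) ↔ ∃ t ∈ gen a i, ∃ c, s = t + c * a (i + 1) := by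
  constructor
  · rintro ⟨c, hc⟩
    rw [Finset.sum_range_succ] at hc
    exact ⟨_, ⟨c, rfl⟩, c (i + 1), hc⟩
  · rintro ⟨t, ⟨c, rfl⟩, k, rfl⟩
    refine ⟨Function.update c (i + 1) k, ?_⟩
    rw [Finset.sum_range_succ _ (i + 1), Function.update_self]
    congr 1
    refine Finset.sum_congr rfl fun j hj => ?_
    rw [Function.update_of_ne (Finset.mem_range.mp hj).ne]

theorem add_mem_gen {a : ℕ → ℕ} {i s t : ℕ} (hs : s ∈ gen a i) (ht : t ∈ gen a i) :
    s + t ∈ gen a i := by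
  obtain ⟨c, rfl⟩ := hs
  obtain ⟨d, rfl⟩ := ht
  exact ⟨c + d, by simp [add_mul, Finset.sum_add_distrib]⟩

theorem mul_mem_gen {a : ℕ → ℕ} {i s : ℕ} (k : ℕ) (hs : s ∈ gen a i) : k * s ∈ gen a i := by
  obtain ⟨c, rfl⟩ := hs
  exact ⟨fun j => k * c j, by simp [Finset.mul_sum, mul_assoc]⟩

theorem eSeq_dvd_of_mem_gen {a : ℕ → ℕ} {i s : ℕ} (hs : s ∈ gen a i) : eSeq a i ∣ s := by
  induction i generalizing s with
  | zero =>
    obtain ⟨c, rfl⟩ := mem_gen_zero.mp hs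
    exact dvd_mul_left _ _
  | succ i ih =>
    obtain ⟨t, ht, c, rfl⟩ := mem_gen_succ.mp hs
    exact dvd_add ((Nat.gcd_dvd_left _ _).trans (ih ht))
      ((Nat.gcd_dvd_right _ _).mul_left c)

theorem eSeq_pos {a : ℕ → ℕ} (h : 0 < a 0) (i : ℕ) : 0 < eSeq a i := by
  induction i with
  | zero => exact h
  | succ i ih => exact Nat.gcd_pos_of_pos_left _ ih

/-- The expected Frobenius number of `gen a i` among the multiples of `eSeq a i`. -/
def frobeniusSeq (a : ℕ → ℕ) (i : ℕ) : ℤ :=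
  (∑ j ∈ Finset.Icc 1 i, ((nSeq a j : ℤ) - 1) * (a j : ℤ)) - (a 0 : ℤ)

theorem frobeniusSeq_succ (a : ℕ → ℕ) (i : ℕ) :
    frobeniusSeq a (i + 1) =
      frobeniusSeq a i + ((nSeq a (i + 1) : ℤ) - 1) * (a (i + 1) : ℤ) := by
  simp only [frobeniusSeq, Finset.sum_Icc_succ_top (Nat.le_add_left 1 i)]
  ring

/-- With `gcd d b = e` and `d = n * e`, the multiples of `b` by `0, …, n - 1` represent all
multiples of `e` modulo `d`. -/
theorem exists_dvd_sub_mul {d b n : ℕ} (hn : 0 < n) (hd : d = n * Nat.gcd d b) {z : ℤ}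
    (hz : (Nat.gcd d b : ℤ) ∣ z) : ∃ c : ℕ, c < n ∧ (d : ℤ) ∣ z - c * b := by
  obtain ⟨w, rfl⟩ := hz
  have hbez := Nat.gcd_eq_gcd_ab d b
  set e := Nat.gcd d b
  obtain ⟨m, hm⟩ : e ∣ b := Nat.gcd_dvd_right d b
  have hn' : (0 : ℤ) < n := by exact_mod_cast hn
  set u := w * Nat.gcdB d b
  have h0 := Int.emod_nonneg u hn'.ne'
  have h1 := Int.emod_lt_of_pos u hn'
  have h2 := Int.mul_ediv_add_emod u n
  refine ⟨(u % n).toNat, by omega, w * Nat.gcdA d b + (u / n) * m, ?_⟩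
  rw [Int.toNat_of_nonneg h0]
  have hdZ : (d : ℤ) = n * e := by exact_mod_cast hd
  have hmZ : (b : ℤ) = e * m := by exact_mod_cast hm
  have hu : u = w * Nat.gcdB d b := rfl
  linear_combination w * hbez - (b : ℤ) * h2 - (b : ℤ) * hu + (u / n) * n * hmZ - (u / n) * m * hdZ

theorem dvd_of_dvd_mul_of_eq_mul_gcd {d b n : ℕ} (hpos : 0 < d) (hd : d = n * Nat.gcd d b) {k : ℤ}
    (h : (d : ℤ) ∣ k * b) : (n : ℤ) ∣ k := by
  have he : 0 < Nat.gcd d b := Nat.gcd_pos_of_pos_left _ hpos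
  have hq : d / Nat.gcd d b = n := Nat.div_eq_of_eq_mul_left he hd
  have hcop : IsCoprime (n : ℤ) ((b / Nat.gcd d b : ℕ) : ℤ) := by
    rw [Nat.isCoprime_iff_coprime, ← hq]
    exact Nat.coprime_div_gcd_div_gcd he
  refine hcop.dvd_of_dvd_mul_right ?_
  have hb : (b : ℤ) = (b / Nat.gcd d b : ℕ) * (Nat.gcd d b : ℕ) := by
    exact_mod_cast (Nat.div_mul_cancel (Nat.gcd_dvd_right d b)).symm
  have hdZ : (d : ℤ) = n * (Nat.gcd d b : ℕ) := by exact_mod_cast hd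
  refine Int.dvd_of_mul_dvd_mul_right (a := ((Nat.gcd d b : ℕ) : ℤ)) (by exact_mod_cast he.ne') ?_
  rw [← hdZ, mul_assoc, ← hb]
  exact h

theorem isGreatest_frobeniusSeq {a : ℕ → ℕ} (h0 : 0 < a 0) (i : ℕ)
    (hfree : ∀ j, 1 ≤ j → j ≤ i → nSeq a j * a j ∈ gen a (j - 1)) :
    IsGreatest {z : ℤ | (eSeq a i : ℤ) ∣ z ∧ ¬ ∃ s ∈ gen a i, (s : ℤ) = z}
      (frobeniusSeq a i) := by
  induction i with
  | zero =>
    have h0' : (0 : ℤ) < a 0 := by exact_mod_cast h0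
    have hF : frobeniusSeq a 0 = -(a 0 : ℤ) := by simp [frobeniusSeq]
    rw [hF]
    refine ⟨⟨by simp [eSeq], ?_⟩, ?_⟩
    · rintro ⟨s, -, hs⟩
      omega
    · rintro z ⟨⟨k, rfl⟩, hz⟩
      simp only [eSeq] at hz ⊢
      by_contra! hlt
      have hk : 0 ≤ k := by
        by_contra! hk
        nlinarith
      refine hz ⟨k.toNat * a 0, mem_gen_zero.mpr ⟨_, rfl⟩, ?_⟩
      push_cast
      rw [Int.toNat_of_nonneg hk, mul_comm]
  | succ i ih =>
    obtain ⟨⟨hdvd, hnot⟩, hmax⟩ := ih fun j h1 h2 => hfree j h1 (by omega)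
    have hnb := hfree (i + 1) (by omega) le_rfl
    rw [Nat.add_sub_cancel] at hnb
    have hd : eSeq a i = nSeq a (i + 1) * Nat.gcd (eSeq a i) (a (i + 1)) :=
      (Nat.div_mul_cancel (Nat.gcd_dvd_left _ _)).symm
    have hdpos := eSeq_pos h0 i
    have hn : 0 < nSeq a (i + 1) := Nat.pos_of_ne_zero fun h => by simp [h] at hd; omega
    rw [frobeniusSeq_succ]
    set n := nSeq a (i + 1)
    set b := a (i + 1)
    set d := eSeq a i
    have hed : ((eSeq a (i + 1) : ℕ) : ℤ) ∣ d := by exact_mod_cast Nat.gcd_dvd_left d b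
    have heb : ((eSeq a (i + 1) : ℕ) : ℤ) ∣ b := by exact_mod_cast Nat.gcd_dvd_right d b
    refine ⟨⟨dvd_add (hed.trans hdvd) (heb.mul_left _), ?_⟩, ?_⟩
    · rintro ⟨s, hs, hsF⟩
      obtain ⟨t, ht, c, rfl⟩ := mem_gen_succ.mp hs
      push_cast at hsF
      have htd : (d : ℤ) ∣ t := by exact_mod_cast eSeq_dvd_of_mem_gen ht
      have hk : (n : ℤ) ∣ c - n + 1 := by
        refine dvd_of_dvd_mul_of_eq_mul_gcd hdpos hd ?_
        have : ((c : ℤ) - n + 1) * b = frobeniusSeq a i - t := by linear_combination hsF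
        rw [this]
        exact dvd_sub hdvd htd
      obtain ⟨k, hk⟩ := hk
      have hk0 : 0 ≤ k := by
        by_contra! hk0
        nlinarith
      lift k to ℕ using hk0
      refine hnot ⟨t + k * (n * b), add_mem_gen ht (mul_mem_gen k hnb), ?_⟩
      push_cast
      linear_combination hsF - (b : ℤ) * hk
    · rintro z ⟨hez, hz⟩
      by_contra! hlt
      obtain ⟨c, hcn, hcd⟩ := exists_dvd_sub_mul hn hd hez
      have hgt : frobeniusSeq a i < z - c * b := by
        have hcn' : (c : ℤ) ≤ n - 1 := by omega
        have := mul_le_mul_of_nonneg_right hcn' (Int.natCast_nonneg b)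
        linarith
      have hmem : ∃ s ∈ gen a i, (s : ℤ) = z - c * b := by
        by_contra h
        exact absurd (hmax ⟨hcd, h⟩) (not_le.mpr hgt)
      obtain ⟨s, hs, hsz⟩ := hmem
      refine hz ⟨s + c * b, mem_gen_succ.mpr ⟨s, hs, c, rfl⟩, ?_⟩
      push_cast
      linarith

theorem gen_subset_of_perm {g : ℕ} {a a' : ℕ → ℕ} (σ : Equiv.Perm (Fin (g + 1)))
    (h : ∀ i : Fin (g + 1), a' i.val = a (σ i).val) : gen a g ⊆ gen a' g := by
  rintro s ⟨c, rfl⟩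
  refine ⟨fun j => if hj : j < g + 1 then c (σ ⟨j, hj⟩) else 0, ?_⟩
  rw [Finset.sum_range, Finset.sum_range, ← Equiv.sum_comp σ]
  exact Finset.sum_congr rfl fun i _ => by simp [h, i.isLt]

theorem stmt_15 (g : ℕ) (a a' : ℕ → ℕ) (hpos : ∀ i, i ≤ g → 0 < a i)
    (hperm : ∃ σ : Equiv.Perm (Fin (g + 1)), ∀ i : Fin (g + 1), a' i.val = a (σ i).val)
    (hfree : IsFreeArr a g) (hfree' : IsFreeArr a' g) :
    (∑ i ∈ Finset.Icc 1 g, ((nSeq a i : ℤ) - 1) * (a i : ℤ)) - (a 0 : ℤ) =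
      (∑ i ∈ Finset.Icc 1 g, ((nSeq a' i : ℤ) - 1) * (a' i : ℤ)) - (a' 0 : ℤ) := by
  obtain ⟨σ, hσ⟩ := hperm
  have hgen : gen a g = gen a' g :=
    (gen_subset_of_perm σ hσ).antisymm (gen_subset_of_perm σ.symm fun i => by simp [hσ])
  have h0' : 0 < a' 0 := by
    have := hσ 0
    rw [Fin.val_zero] at this
    rw [this]
    exact hpos _ (Nat.le_of_lt_succ (σ 0).isLt)
  have h := isGreatest_frobeniusSeq (hpos 0 (Nat.zero_le g)) g hfree.2
  have h' := isGreatest_frobeniusSeq h0' g hfree'.2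
  rw [hfree.1, hgen] at h
  rw [hfree'.1] at h'
  exact h.unique h'
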